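/- arXiv:2009.02991 — 3 statements merged into one kernel-verified Lean document; each statement's English description precedes it below -/
import Mathlib

section
/- Let F be a field and Q₁, Q₂ ⊆ F^n two linear codes having the same set of circuits 𝒞, and suppose they have the same derived matroid, i.e.: for every finite set 𝒮 ⊆ 𝒞 and every choice of circuit vectors v_C ∈ Q₁^⊥ and w_C ∈ Q₂^⊥ of C for each C ∈ 𝒮, the family (v_C)_{C∈𝒮} is F-linearly independent if and only if the family (w_C)_{C∈𝒮} is. Then for every connected collusion pattern 𝒯 on {1,…,n} the matroids of the lifts coincide: for every S ⊆ {1,…,n}, (Q₁^𝒯)^⊥ contains a nonzero vector with support contained in S if and only if (Q₂^𝒯)^⊥ does. Here 𝒯 is connected if there is no partition of {1,…,n} into two nonempty sets A and B such that every T ∈ 𝒯 is contained in A or contained in B. -/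
/-- The dual code of a set of vectors `Q ⊆ F^ι`. -/
def dualCode {F : Type*} [Field F] {ι : Type*} [Fintype ι] (Q : Set (ι → F)) :
    Set (ι → F) :=
  {v | ∀ x ∈ Q, ∑ i, v i * x i = 0}

/-- The support of a vector. -/
def supp {F : Type*} [Zero F] {ι : Type*} (v : ι → F) : Set ι := {i | v i ≠ 0}

/-- The lift of a code `Q` over a collection `𝒯` of subsets of the coordinate set. -/
def lift {F : Type*} {ι : Type*} (Q : Set (ι → F)) (𝒯 : Set (Set ι)) :
    Set (ι → F) :=
  {x | ∀ T ∈ 𝒯, ∃ y ∈ Q, ∀ i ∈ T, x i = y i}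

/-- A collusion pattern: a collection of subsets closed under taking subsets. -/
def IsCollusionPattern {ι : Type*} (𝒯 : Set (Set ι)) : Prop :=
  ∀ T ∈ 𝒯, ∀ T' ⊆ T, T' ∈ 𝒯

/-- A circuit of a code `Q`: the support of a nonzero dual vector that is
minimal among supports of nonzero dual vectors. -/
def IsCircuit {F : Type*} [Field F] {ι : Type*} [Fintype ι] (Q : Set (ι → F))
    (C : Set ι) : Prop :=
  (∃ v ∈ dualCode Q, v ≠ 0 ∧ supp v = C) ∧
    ∀ w ∈ dualCode Q, w ≠ 0 → ¬ supp w ⊂ C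

/-- The submodule of vectors supported in `S`. -/
def supportedSubmodule (F : Type*) [Field F] {ι : Type*} (S : Set ι) : Submodule F (ι → F) where
  carrier := {v | supp v ⊆ S}
  zero_mem' := by intro i hi; simp [supp] at hi
  add_mem' := by
    intro a b ha hb i hi
    by_contra h
    have h1 : a i = 0 := by by_contra h'; exact h (ha h')
    have h2 : b i = 0 := by by_contra h'; exact h (hb h')
    simp [supp, h1, h2] at hi
  smul_mem' := by
    intro r a ha i hi
    refine ha fun h => hi ?_
    simp [h]

theorem mem_supportedSubmodule {F : Type*} [Field F] {ι : Type*} {S : Set ι} {v : ι → F} :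
    v ∈ supportedSubmodule F S ↔ supp v ⊆ S := Iff.rfl

section Circuits

variable {F : Type*} [Field F] {ι : Type*} [Fintype ι]

/-- The dual code as a submodule. -/
def dualSubmodule (Q : Set (ι → F)) : Submodule F (ι → F) where
  carrier := dualCode Q
  zero_mem' := by intro x _; simp
  add_mem' := by
    intro a b ha hb x hx
    simp [add_mul, Finset.sum_add_distrib, ha x hx, hb x hx]
  smul_mem' := by
    intro r a ha x hx
    simp [mul_assoc, ← Finset.mul_sum, ha x hx]

/-- A vector orthogonal to the dual of a subspace lies in the subspace. -/
theorem mem_of_forall_dualCode (R : Submodule F (ι → F)) (x : ι → F)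
    (h : ∀ v ∈ dualCode (R : Set (ι → F)), ∑ i, v i * x i = 0) : x ∈ R := by
  classical
  by_contra hx
  obtain ⟨f, hfx, hf⟩ := R.exists_le_ker_of_notMem hx
  have key : ∀ y, ∑ i, f (Pi.single i 1) * y i = f y := by
    intro y
    conv_rhs => rw [pi_eq_sum_univ' y, map_sum]
    refine Finset.sum_congr rfl fun i _ => ?_
    rw [map_smul, smul_eq_mul, mul_comm]
  refine hfx ?_
  rw [← key x]
  exact h (fun i => f (Pi.single i 1)) fun y hy => (key y).trans (hf hy)

/-- `c` chooses a circuit vector of `Q` for every circuit of `Q`. -/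
def IsCircuitChoice (Q : Set (ι → F)) (c : Set ι → ι → F) : Prop :=
  ∀ C, IsCircuit Q C → c C ∈ dualCode Q ∧ c C ≠ 0 ∧ supp (c C) = C

theorem exists_isCircuitChoice (Q : Set (ι → F)) : ∃ c, IsCircuitChoice Q c := by
  choose! c hc using fun C (h : IsCircuit Q C) => h.1
  exact ⟨c, hc⟩

theorem exists_isCircuit_subset_supp {Q : Set (ι → F)} {v : ι → F} (hv : v ∈ dualCode Q)
    (hv0 : v ≠ 0) : ∃ C, IsCircuit Q C ∧ C ⊆ supp v := by
  obtain ⟨C, hC, hmin⟩ := (Set.toFinite {C : Set ι | ∃ w ∈ dualCode Q, w ≠ 0 ∧ supp w = C}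
    ).exists_le_minimal (a := supp v) ⟨v, hv, hv0, rfl⟩
  exact ⟨C, ⟨hmin.prop, fun w hw hw0 hlt => hmin.not_prop_of_lt hlt ⟨w, hw, hw0, rfl⟩⟩, hC⟩

/-- Circuit vectors span the dual vectors supported in a given set. -/
theorem mem_span_circuits {Q : Set (ι → F)} {c : Set ι → ι → F} (hc : IsCircuitChoice Q c)
    (T : Set ι) (v : ι → F) (hv : v ∈ dualCode Q) (hT : supp v ⊆ T) :
    v ∈ Submodule.span F (c '' {C | IsCircuit Q C ∧ C ⊆ T}) := by
  induction hk : (supp v).ncard using Nat.strong_induction_on generalizing v with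
  | _ k ih =>
  by_cases hv0 : v = 0
  · rw [hv0]; exact zero_mem _
  obtain ⟨C, hC, hCv⟩ := exists_isCircuit_subset_supp hv hv0
  obtain ⟨hcd, hc0, hcs⟩ := hc C hC
  obtain ⟨i, hi⟩ := Function.ne_iff.1 hc0
  have hiC : i ∈ C := hcs ▸ hi
  have hmem : c C ∈ Submodule.span F (c '' {C | IsCircuit Q C ∧ C ⊆ T}) :=
    Submodule.subset_span ⟨C, ⟨hC, hCv.trans hT⟩, rfl⟩
  set w := v - (v i / c C i) • c C with hw
  have hwd : w ∈ dualSubmodule Q := sub_mem hv (Submodule.smul_mem _ _ hcd)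
  have hsub : supp w ⊆ supp v :=
    mem_supportedSubmodule.1 <| Submodule.sub_mem _ (mem_supportedSubmodule.2 subset_rfl)
      (Submodule.smul_mem _ _ (mem_supportedSubmodule.2 (hcs.subset.trans hCv)))
  have hwi : w i = 0 := by
    have : c C i ≠ 0 := hi
    simp [hw, this]
  have hss : supp w ⊂ supp v := ⟨hsub, fun h => h (hCv hiC) hwi⟩
  have := ih _ (hk ▸ Set.ncard_lt_ncard hss (Set.toFinite _)) w hwd (hsub.trans hT) rfl
  have hvw : v = w + (v i / c C i) • c C := by simp [hw]
  rw [hvw]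
  exact add_mem this (Submodule.smul_mem _ _ hmem)

/-- The dual of a lift is spanned by the circuit vectors supported in the collusion pattern. -/
theorem dualSubmodule_lift (Q : Submodule F (ι → F)) {c : Set ι → ι → F}
    (hc : IsCircuitChoice (Q : Set (ι → F)) c) {𝒯 : Set (Set ι)} (h𝒯 : IsCollusionPattern 𝒯) :
    dualSubmodule (lift (Q : Set (ι → F)) 𝒯) =
      Submodule.span F (c '' {C | IsCircuit (Q : Set (ι → F)) C ∧ C ∈ 𝒯}) := by
  classical
  apply le_antisymm
  · intro u hu
    refine mem_of_forall_dualCode _ u fun x hx => ?_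
    rw [← hu x]
    · simp only [mul_comm]
    intro T hT
    have hxR : x ∈ Q ⊔ supportedSubmodule F Tᶜ := by
      refine mem_of_forall_dualCode _ x fun v hv => ?_
      have hvQ : v ∈ dualCode (Q : Set (ι → F)) := fun y hy =>
        hv y (Submodule.mem_sup_left hy)
      have hvT : supp v ⊆ T := by
        intro i hi
        by_contra hiT
        have hs : (Pi.single i 1 : ι → F) ∈ supportedSubmodule F Tᶜ := by
          intro j hj
          by_cases hji : j = i
          · exact hji ▸ hiT
          · exact absurd (Pi.single_eq_of_ne hji 1) hj
        have := hv _ (Submodule.mem_sup_right hs)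
        simp [Pi.single_apply] at this
        exact hi this
      have hmem := Submodule.span_mono (R := F) (Set.image_mono
        (fun C (hC : IsCircuit (Q : Set (ι → F)) C ∧ C ⊆ T) =>
          (⟨hC.1, h𝒯 T hT C hC.2⟩ : IsCircuit (Q : Set (ι → F)) C ∧ C ∈ 𝒯)))
        (mem_span_circuits hc T v hvQ hvT)
      rw [← hx v hmem]
      simp only [mul_comm]
    obtain ⟨y, hy, z, hz, rfl⟩ := Submodule.mem_sup.1 hxR
    refine ⟨y, hy, fun i hi => ?_⟩
    have : z i = 0 := by by_contra h; exact hz h hi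
    simp [this]
  · rw [Submodule.span_le]
    rintro _ ⟨C, ⟨hC, hCT⟩, rfl⟩ x hx
    obtain ⟨y, hy, hxy⟩ := hx C hCT
    obtain ⟨hcd, -, hcs⟩ := hc C hC
    rw [← hcd y hy]
    refine Finset.sum_congr rfl fun i _ => ?_
    by_cases hi : i ∈ C
    · rw [hxy i hi]
    · have : c C i = 0 := by by_contra h; exact hi (hcs ▸ h)
      simp [this]

theorem exists_dual_lift_iff (Q : Submodule F (ι → F)) {c : Set ι → ι → F}
    (hc : IsCircuitChoice (Q : Set (ι → F)) c) {𝒯 : Set (Set ι)} (h𝒯 : IsCollusionPattern 𝒯)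
    (S : Set ι) :
    (∃ u ∈ dualCode (lift (Q : Set (ι → F)) 𝒯), u ≠ 0 ∧ supp u ⊆ S) ↔
      Submodule.span F (c '' {C | IsCircuit (Q : Set (ι → F)) C ∧ C ∈ 𝒯}) ⊓
        Submodule.span F (c '' {C | IsCircuit (Q : Set (ι → F)) C ∧ C ⊆ S}) ≠ ⊥ := by
  rw [Submodule.ne_bot_iff, ← dualSubmodule_lift Q hc h𝒯]
  constructor
  · rintro ⟨u, hu, hu0, huS⟩
    refine ⟨u, ⟨hu, mem_span_circuits hc S u ?_ huS⟩, hu0⟩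
    exact fun x hx => hu x fun T _ => ⟨x, hx, fun _ _ => rfl⟩
  · rintro ⟨u, ⟨hu, huS⟩, hu0⟩
    refine ⟨u, hu, hu0, ?_⟩
    have hle : Submodule.span F (c '' {C | IsCircuit (Q : Set (ι → F)) C ∧ C ⊆ S}) ≤
        supportedSubmodule F S := by
      rw [Submodule.span_le]
      rintro _ ⟨C, ⟨hC, hCS⟩, rfl⟩
      exact (hc C hC).2.2.subset.trans hCS
    exact hle huS

end Circuits

/-- Families with the same independent subsets have spans of the same dimension. -/
theorem finrank_span_image_le {K V W α : Type*} [Field K] [AddCommGroup V] [Module K V]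
    [AddCommGroup W] [Module K W] [FiniteDimensional K W] {v : α → V} {w : α → W} {A : Set α}
    (hA : A.Finite) (h : ∀ b ⊆ A, LinearIndepOn K v b → LinearIndepOn K w b) :
    Module.finrank K (Submodule.span K (v '' A)) ≤
      Module.finrank K (Submodule.span K (w '' A)) := by
  obtain ⟨b, hbA, -, hspan, hb⟩ :=
    exists_linearIndepOn_extension (linearIndepOn_empty K v) (Set.empty_subset A)
  have hwb := h b hbA hb
  have : Fintype b := (hA.subset hbA).fintype
  have hr := finrank_span_eq_card hb
  rw [← Set.image_eq_range v b] at hr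
  have hr' := finrank_span_eq_card hwb
  rw [← Set.image_eq_range w b] at hr'
  have heq : Submodule.span K (v '' A) = Submodule.span K (v '' b) :=
    le_antisymm (Submodule.span_le.2 hspan) (Submodule.span_mono (Set.image_mono hbA))
  rw [heq, hr, ← hr']
  exact Submodule.finrank_mono (Submodule.span_mono (Set.image_mono hbA))

theorem statement12 {F : Type*} [Field F] {n : ℕ} (Q₁ Q₂ : Submodule F (Fin n → F))
    (hsame : ∀ C : Set (Fin n),
      IsCircuit (Q₁ : Set (Fin n → F)) C ↔ IsCircuit (Q₂ : Set (Fin n → F)) C)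
    (hderived : ∀ (𝒮 : Finset (Set (Fin n))) (v w : Set (Fin n) → (Fin n → F)),
      (∀ C ∈ 𝒮, IsCircuit (Q₁ : Set (Fin n → F)) C) →
      (∀ C ∈ 𝒮, v C ∈ dualCode (Q₁ : Set (Fin n → F)) ∧ v C ≠ 0 ∧ supp (v C) = C) →
      (∀ C ∈ 𝒮, w C ∈ dualCode (Q₂ : Set (Fin n → F)) ∧ w C ≠ 0 ∧ supp (w C) = C) →
      (LinearIndependent F (fun C : 𝒮 => v (C : Set (Fin n))) ↔
        LinearIndependent F (fun C : 𝒮 => w (C : Set (Fin n)))))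
    (𝒯 : Set (Set (Fin n))) (h𝒯 : IsCollusionPattern 𝒯)
    (hconn : ¬ ∃ A B : Set (Fin n), A.Nonempty ∧ B.Nonempty ∧ A ∪ B = Set.univ ∧
        Disjoint A B ∧ ∀ T ∈ 𝒯, T ⊆ A ∨ T ⊆ B) :
    ∀ S : Set (Fin n),
      (∃ u ∈ dualCode (lift (Q₁ : Set (Fin n → F)) 𝒯), u ≠ 0 ∧ supp u ⊆ S) ↔
      (∃ u ∈ dualCode (lift (Q₂ : Set (Fin n → F)) 𝒯), u ≠ 0 ∧ supp u ⊆ S) := by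
  intro S
  obtain ⟨v, hv⟩ := exists_isCircuitChoice (Q₁ : Set (Fin n → F))
  obtain ⟨w, hw⟩ := exists_isCircuitChoice (Q₂ : Set (Fin n → F))
  rw [exists_dual_lift_iff Q₁ hv h𝒯 S, exists_dual_lift_iff Q₂ hw h𝒯 S]
  simp only [← hsame]
  set A := {C | IsCircuit (Q₁ : Set (Fin n → F)) C ∧ C ∈ 𝒯}
  set B := {C | IsCircuit (Q₁ : Set (Fin n → F)) C ∧ C ⊆ S}
  have hind : ∀ b : Set (Set (Fin n)), (∀ C ∈ b, IsCircuit (Q₁ : Set (Fin n → F)) C) →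
      (LinearIndepOn F v b ↔ LinearIndepOn F w b) := by
    intro b hb
    obtain ⟨s, rfl⟩ := (Set.toFinite b).exists_finset_coe
    exact hderived s v w hb (fun C hC => hv C (hb C hC))
      (fun C hC => hw C ((hsame C).1 (hb C hC)))
  have hrank : ∀ X : Set (Set (Fin n)), (∀ C ∈ X, IsCircuit (Q₁ : Set (Fin n → F)) C) →
      Module.finrank F (Submodule.span F (v '' X)) =
        Module.finrank F (Submodule.span F (w '' X)) := fun X hX =>
    le_antisymm
      (finrank_span_image_le X.toFinite fun b hb => (hind b fun C hC => hX C (hb hC)).1)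
      (finrank_span_image_le X.toFinite fun b hb => (hind b fun C hC => hX C (hb hC)).2)
  have hA := hrank A fun C hC => hC.1
  have hB := hrank B fun C hC => hC.1
  have hAB := hrank (A ∪ B) fun C hC => hC.elim And.left And.left
  rw [Set.image_union, Set.image_union, Submodule.span_union, Submodule.span_union] at hAB
  have hdv := Submodule.finrank_sup_add_finrank_inf_eq
    (Submodule.span F (v '' A)) (Submodule.span F (v '' B))
  have hdw := Submodule.finrank_sup_add_finrank_inf_eq
    (Submodule.span F (w '' A)) (Submodule.span F (w '' B))
  rw [Ne, Ne, ← Submodule.finrank_eq_zero (R := F), ← Submodule.finrank_eq_zero (R := F)]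
  omega
end

section
/- Let F be a field and Q ⊆ F^n a linear code of dimension t−1. Let C₁, …, C_{n−t+1} be circuits of Q admitting a triangular ordering, i.e. there exist elements e₁, …, e_{n−t+1} with e_i ∈ C_i for every i and {e₁, …, e_{i−1}} ∩ C_i = ∅ for every i > 1. Let 𝒯 be the collusion pattern generated by C₁, …, C_{n−t+1}, i.e. 𝒯 = {T : T ⊆ C_i for some i}. Then Q^𝒯 = Q. -/
/-- Vectors `v i` that are nonzero at pivots `e i`, each vanishing at all earlier pivots,
are linearly independent. -/
theorem linearIndependent_of_triangular {F ι : Type*} [Field F] {m : ℕ}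
    (v : Fin m → ι → F) (e : Fin m → ι) (hdiag : ∀ i, v i (e i) ≠ 0)
    (htri : ∀ i j, j < i → v i (e j) = 0) : LinearIndependent F v := by
  let A : Matrix (Fin m) (Fin m) F := Matrix.of fun i j => v i (e j)
  have hA : A.BlockTriangular id := fun i j hij => htri i j hij
  have hdet : A.det ≠ 0 := by
    rw [Matrix.det_of_isUpperTriangular hA]
    exact Finset.prod_ne_zero_iff.mpr fun i _ => hdiag i
  exact LinearIndependent.of_comp (LinearMap.funLeft F F e)
    (Matrix.linearIndependent_rows_of_det_ne_zero hdet)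

/-- A dual vector supported on a member of `𝒯` annihilates the lift over `𝒯`. -/
theorem sum_mul_eq_zero_of_mem_lift {F ι : Type*} [Field F] [Fintype ι] {Q : Set (ι → F)}
    {𝒯 : Set (Set ι)} {v x : ι → F} (hv : v ∈ dualCode Q) (hT : supp v ∈ 𝒯)
    (hx : x ∈ lift Q 𝒯) : ∑ i, v i * x i = 0 := by
  obtain ⟨y, hy, hxy⟩ := hx _ hT
  rw [← hv y hy]
  refine Finset.sum_congr rfl fun i _ => ?_
  by_cases hi : v i = 0
  · simp [hi]
  · rw [hxy i hi]

theorem statement17 {F : Type*} [Field F] {n t : ℕ} (ht : 1 ≤ t)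
    (Q : Submodule F (Fin n → F)) (hdim : Module.finrank F Q = t - 1)
    (C : Fin (n - t + 1) → Set (Fin n))
    (hC : ∀ i, IsCircuit (Q : Set (Fin n → F)) (C i))
    (e : Fin (n - t + 1) → Fin n) (he : ∀ i, e i ∈ C i)
    (htri : ∀ i j, j < i → e j ∉ C i) :
    lift (Q : Set (Fin n → F)) {T | ∃ i, T ⊆ C i} = (Q : Set (Fin n → F)) := by
  refine Set.Subset.antisymm (fun x hx => ?_) fun x hx _ _ => ⟨x, hx, fun _ _ => rfl⟩
  choose v hv _ hsupp using fun i => (hC i).1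
  have hli : LinearIndependent F v := by
    refine linearIndependent_of_triangular v e (fun i => ?_) fun i j hij => ?_
    · have h := he i
      rwa [← hsupp i] at h
    · have h := htri i j hij
      rw [← hsupp i] at h
      exact not_not.mp h
  let A : Matrix (Fin (n - t + 1)) (Fin n) F := Matrix.of v
  have hrank : A.rank = n - t + 1 := by
    simpa using LinearIndependent.rank_matrix (M := A) hli
  have hle : Q ≤ LinearMap.ker A.mulVecLin := fun y hy =>
    LinearMap.mem_ker.mpr (funext fun i => hv i y hy)
  have hsum := LinearMap.finrank_range_add_finrank_ker A.mulVecLin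
  rw [← Matrix.rank, hrank, Module.finrank_fin_fun] at hsum
  have hker : Q = LinearMap.ker A.mulVecLin :=
    Submodule.eq_of_le_of_finrank_le hle (by omega)
  rw [hker]
  refine LinearMap.mem_ker.mpr (funext fun i => ?_)
  exact sum_mul_eq_zero_of_mem_lift (𝒯 := {T | ∃ i, T ⊆ C i}) (hv i) ⟨i, (hsupp i).subset⟩ hx
end

section
/- Let F be a field and Q ⊆ F^n a linear code whose matroid is connected. Fix e ∈ {1,…,n} and let 𝒯 be the collusion pattern generated by all circuits of Q containing e, i.e. 𝒯 = {T : T ⊆ C for some circuit C of Q with e ∈ C}. Then Q^𝒯 = Q. -/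
theorem sub_smul_mem_dualCode {F : Type*} [Field F] {ι : Type*} [Fintype ι] {Q : Set (ι → F)}
    {v w : ι → F} (hv : v ∈ dualCode Q) (hw : w ∈ dualCode Q) (t : F) :
    v - t • w ∈ dualCode Q := by
  intro x hx
  have h : ∑ i, (v - t • w) i * x i = ∑ i, v i * x i - t * ∑ i, w i * x i := by
    rw [Finset.mul_sum, ← Finset.sum_sub_distrib]
    exact Finset.sum_congr rfl fun i _ => by simp; ring
  rw [h, hv x hx, hw x hx]
  simp

theorem supp_sub_smul_subset {F : Type*} [Field F] {ι : Type*} (v w : ι → F) (t : F) :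
    supp (v - t • w) ⊆ supp v ∪ supp w := by
  intro i hi
  by_contra h
  simp only [supp, Set.mem_union, Set.mem_ofPred_eq, not_or, not_not] at h
  exact hi (by simp [h.1, h.2])

/-- Eliminating a coordinate of `w` from `v` strictly shrinks the support of `v`
when `supp w ⊆ supp v`. -/
theorem supp_eliminate_ssubset {F : Type*} [Field F] {ι : Type*} {v w : ι → F} {g : ι}
    (hwv : supp w ⊆ supp v) (hg : g ∈ supp w) :
    supp (v - (v g / w g) • w) ⊂ supp v := by
  refine ⟨(supp_sub_smul_subset v w _).trans (Set.union_subset subset_rfl hwv), fun h => ?_⟩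
  have hg' : w g ≠ 0 := hg
  exact h (hwv hg) (by simp [hg'])

/-- Every coordinate in the support of a dual vector lies in a circuit contained in the support. -/
theorem exists_circuit_vector {F : Type*} [Field F] {ι : Type*} [Fintype ι] {Q : Set (ι → F)}
    {v : ι → F} (hv : v ∈ dualCode Q) {g : ι} (hg : g ∈ supp v) :
    ∃ w ∈ dualCode Q, g ∈ supp w ∧ supp w ⊆ supp v ∧ IsCircuit Q (supp w) := by
  induction hS : supp v using WellFoundedLT.induction generalizing v with
  | ind S ih =>
    subst hS
    by_cases hC : IsCircuit Q (supp v)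
    · exact ⟨v, hv, hg, subset_rfl, hC⟩
    have hv0 : v ≠ 0 := by rintro rfl; exact hg rfl
    have hsmall : ∃ u ∈ dualCode Q, u ≠ 0 ∧ supp u ⊂ supp v := by
      by_contra! h
      exact hC ⟨⟨v, hv, hv0, rfl⟩, h⟩
    obtain ⟨u, hu, hu0, huv⟩ := hsmall
    by_cases hgu : g ∈ supp u
    · obtain ⟨w, hw, hgw, hwu, hwC⟩ := ih _ huv hu hgu rfl
      exact ⟨w, hw, hgw, hwu.trans huv.1, hwC⟩
    · obtain ⟨k, hk⟩ := Function.ne_iff.mp hu0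
      have hlt := supp_eliminate_ssubset (g := k) huv.1 hk
      have hug : u g = 0 := not_not.mp hgu
      have hge : g ∈ supp (v - (v k / u k) • u) := by
        simpa [supp, hug] using hg
      obtain ⟨w, hw, hgw, hwu, hwC⟩ := ih _ hlt (sub_smul_mem_dualCode hv hu _) hge rfl
      exact ⟨w, hw, hgw, hwu.trans hlt.1, hwC⟩

/-- A dual vector supported in a circuit is a multiple of the circuit vector. -/
theorem eq_smul_of_supp_subset_circuit {F : Type*} [Field F] {ι : Type*} [Fintype ι]
    {Q : Set (ι → F)} {d u : ι → F} (hd : d ∈ dualCode Q) (hC : IsCircuit Q (supp d))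
    (hu : u ∈ dualCode Q) (hud : supp u ⊆ supp d) {f : ι} (hf : f ∈ supp d) :
    u = (u f / d f) • d := by
  by_contra h
  refine hC.2 _ (sub_smul_mem_dualCode hu hd (u f / d f)) (sub_ne_zero.mpr h)
    ⟨(supp_sub_smul_subset u d _).trans (Set.union_subset hud subset_rfl), fun hs => ?_⟩
  have hf' : d f ≠ 0 := hf
  exact hs hf (by simp [hf'])

/-- A vector orthogonal to every circuit vector through `e` is orthogonal to each circuit vector
whose support meets some circuit through `e`. -/
theorem dotProduct_circuit_eq_zero {F : Type*} [Field F] {ι : Type*} [Fintype ι]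
    {Q : Set (ι → F)} {e : ι} {x : ι → F}
    (hx : ∀ c ∈ dualCode Q, IsCircuit Q (supp c) → e ∈ supp c → c ⬝ᵥ x = 0)
    {d : ι → F} (hd : d ∈ dualCode Q) (hD : IsCircuit Q (supp d))
    (hconn : ∃ C, IsCircuit Q C ∧ e ∈ C ∧ (C ∩ supp d).Nonempty) :
    d ⬝ᵥ x = 0 := by
  by_cases hed : e ∈ supp d
  · exact hx d hd hD hed
  obtain ⟨C, ⟨hC, heC, f, hfC, hfd⟩, hmin⟩ :=
    exists_minimalFor_of_wellFoundedLT
      (fun C => IsCircuit Q C ∧ e ∈ C ∧ (C ∩ supp d).Nonempty) (fun C => C \ supp d) hconn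
  obtain ⟨c, hc, hc0, rfl⟩ := hC.1
  -- dual vectors through `e` supported in the union agree with `supp c` off `supp d`
  have hfull : ∀ w ∈ dualCode Q, supp w ⊆ supp c ∪ supp d → e ∈ supp w →
      supp c \ supp d ⊆ supp w := by
    intro w hw hwcd hew
    obtain ⟨w', hw', hew', hww', hC'⟩ := exists_circuit_vector hw hew
    have hsub : supp w' \ supp d ⊆ supp c \ supp d := fun i hi =>
      ⟨(hwcd (hww' hi.1)).resolve_right hi.2, hi.2⟩
    by_cases hmeet : (supp w' ∩ supp d).Nonempty
    · exact fun i hi => hww' (hmin ⟨hC', hew', hmeet⟩ hsub hi).1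
    · have hoff : ∀ i ∈ supp w', i ∉ supp d := fun i hi hid => hmeet ⟨i, hi, hid⟩
      refine (hC.2 w' hw' (by rintro rfl; exact hew' rfl) ⟨fun i hi => ?_, fun h => ?_⟩).elim
      · exact (hsub ⟨hi, hoff i hi⟩).1
      · exact hoff f (h hfC) hfd
  have hzero : ∀ u ∈ dualCode Q, supp u ⊆ supp c ∪ supp d → u e = 0 → supp u ⊆ supp d := by
    intro u hu hucd hue g hgu
    by_contra hgd
    have hgc := (hucd hgu).resolve_right hgd
    have hug : u g ≠ 0 := hgu
    refine hfull (c - (c g / u g) • u) (sub_smul_mem_dualCode hc hu _)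
      ((supp_sub_smul_subset _ _ _).trans (Set.union_subset Set.subset_union_left hucd))
      ?_ ⟨hgc, hgd⟩ ?_
    · simpa [supp, hue] using heC
    · simp [hug]
  have hde : d e = 0 := not_not.mp hed
  have hdf : d f ≠ 0 := hfd
  have hcf : c f ≠ 0 := hfC
  obtain ⟨w, hw, hew, hwsub, hwC⟩ := exists_circuit_vector (g := e)
    (sub_smul_mem_dualCode hc hd (c f / d f)) (by simpa [supp, hde] using heC)
  have hwcd := hwsub.trans (supp_sub_smul_subset _ _ _)
  have hwf : w f = 0 := by
    by_contra h
    exact hwsub h (by simp [hdf])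
  have hwe : w e ≠ 0 := hew
  have hu := sub_smul_mem_dualCode hc hw (c e / w e)
  have hud := hzero _ hu
    ((supp_sub_smul_subset _ _ _).trans (Set.union_subset Set.subset_union_left hwcd))
    (by simp [hwe])
  have key := congrArg (· ⬝ᵥ x) (eq_smul_of_supp_subset_circuit hd hD hu hud hfd)
  simpa [sub_dotProduct, smul_dotProduct, hx c hc hC heC, hx w hw hwC hew, hwf, hcf, hdf] using key

/-- A vector orthogonal to every circuit vector is orthogonal to the dual code. -/
theorem dotProduct_eq_zero_of_circuits {F : Type*} [Field F] {ι : Type*} [Fintype ι]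
    {Q : Set (ι → F)} {x : ι → F}
    (hx : ∀ c ∈ dualCode Q, IsCircuit Q (supp c) → c ⬝ᵥ x = 0)
    {v : ι → F} (hv : v ∈ dualCode Q) : v ⬝ᵥ x = 0 := by
  induction hS : supp v using WellFoundedLT.induction generalizing v with
  | ind S ih =>
    subst hS
    by_cases hv0 : v = 0
    · simp [hv0]
    obtain ⟨g, hg⟩ := Function.ne_iff.mp hv0
    obtain ⟨w, hw, hgw, hwv, hwC⟩ := exists_circuit_vector hv hg
    have h := ih _ (supp_eliminate_ssubset hwv hgw) (sub_smul_mem_dualCode hv hw _) rfl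
    simpa [sub_dotProduct, smul_dotProduct, hx w hw hwC] using h

/-- A linear code contains every vector orthogonal to its dual code. -/
theorem mem_of_forall_dualCode_s19 {F : Type*} [Field F] {ι : Type*} [Fintype ι]
    (Q : Submodule F (ι → F)) {x : ι → F}
    (hx : ∀ v ∈ dualCode (Q : Set (ι → F)), v ⬝ᵥ x = 0) : x ∈ Q := by
  classical
  by_contra hxQ
  obtain ⟨φ, hφx, hφQ⟩ := Submodule.exists_le_ker_of_notMem hxQ
  have hφ : ∀ y, (fun i => φ (Pi.single i 1)) ⬝ᵥ y = φ y := fun y => by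
    rw [φ.pi_apply_eq_sum_univ y, dotProduct]
    refine Finset.sum_congr rfl fun i _ => ?_
    rw [smul_eq_mul, mul_comm]
    congr 2
    ext j
    simp [Pi.single_apply, eq_comm]
  exact hφx (hφ x ▸ hx _ fun y hy => (hφ y).trans (hφQ hy))

theorem statement19 {F : Type*} [Field F] {n : ℕ} (Q : Submodule F (Fin n → F))
    (hn : 2 ≤ n)
    (hconn : ∀ i j : Fin n, i ≠ j →
      ∃ C : Set (Fin n), IsCircuit (Q : Set (Fin n → F)) C ∧ i ∈ C ∧ j ∈ C)
    (e : Fin n) :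
    lift (Q : Set (Fin n → F))
        {T | ∃ C : Set (Fin n), IsCircuit (Q : Set (Fin n → F)) C ∧ e ∈ C ∧ T ⊆ C} =
      (Q : Set (Fin n → F)) := by
  refine Set.Subset.antisymm (fun x hx => ?_) fun x hx T _ => ⟨x, hx, fun _ _ => rfl⟩
  have hxe : ∀ c ∈ dualCode (Q : Set (Fin n → F)), IsCircuit (Q : Set (Fin n → F)) (supp c) →
      e ∈ supp c → c ⬝ᵥ x = 0 := by
    intro c hc hC he
    obtain ⟨y, hy, hxy⟩ := hx (supp c) ⟨_, hC, he, subset_rfl⟩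
    rw [← hc y hy]
    refine Finset.sum_congr rfl fun i _ => ?_
    by_cases hi : c i = 0
    · simp [hi]
    · rw [hxy i hi]
  refine mem_of_forall_dualCode_s19 Q fun v hv =>
    dotProduct_eq_zero_of_circuits (fun d hd hD => ?_) hv
  by_cases he : e ∈ supp d
  · exact hxe d hd hD he
  obtain ⟨d', -, hne, hd'⟩ := hD.1
  obtain ⟨f, hf⟩ := Function.ne_iff.mp hne
  have hfd : f ∈ supp d := hd' ▸ hf
  obtain ⟨C, hC, heC, hfC⟩ := hconn e f (by rintro rfl; exact he hfd)
  exact dotProduct_circuit_eq_zero hxe hd hD ⟨C, hC, heC, f, hfC, hfd⟩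
end
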